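/- arXiv:2010.08047 — 15 statements merged into one kernel-verified Lean document; each statement's English description precedes it below -/
import Mathlib

section
/- Let X be a measurable space, p a σ-finite measure on X, f : X → X a measurable bijection with measurable inverse, and g : X → [0,∞] a measurable function with g(x) ≤ 1 for all x. Define the escaping orbital kernel κ(x) = g(x)•δ_{f(x)} + (1 − g(x))•δ_x. Then the kernel leaves p invariant, i.e. p.bind κ = p (equivalently ∫ κ(x)(A) dp(x) = p(A) for every measurable set A), if and only if the pushforward of the measure p.withDensity g under f equals p.withDensity g, i.e. Measure.map f (p.withDensity g) = p.withDensity g. -/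
open MeasureTheory
open scoped ENNReal

/-- The escaping orbital kernel `κ(x) = g(x)•δ_{f(x)} + (1 − g(x))•δ_x` leaves the
σ-finite measure `p` invariant iff `f` pushes forward `p.withDensity g` to itself. -/
theorem escaping_orbital_kernel_invariant_iff
    {X : Type*} [MeasurableSpace X] (p : Measure X) [SigmaFinite p]
    (f : X ≃ᵐ X) (g : X → ℝ≥0∞) (hg : Measurable g) (hg1 : ∀ x, g x ≤ 1) :
    p.bind (fun x => g x • Measure.dirac (f x) + (1 - g x) • Measure.dirac x) = p ↔
      Measure.map f (p.withDensity g) = p.withDensity g := by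
  have hg' : Measurable (fun x => 1 - g x) := measurable_const.sub hg
  have hkey : ∀ A, MeasurableSet A → ∀ x,
      (g x • Measure.dirac (f x) + (1 - g x) • Measure.dirac x) A
        = (f ⁻¹' A).indicator g x + A.indicator (fun x => 1 - g x) x := by
    intro A hA x
    by_cases h1 : f x ∈ A <;> by_cases h2 : x ∈ A <;>
      simp [Measure.dirac_apply' _ hA, Set.indicator, h1, h2]
  have hmeas : Measurable
      (fun x => g x • Measure.dirac (f x) + (1 - g x) • Measure.dirac x) := by
    refine Measure.measurable_of_measurable_coe _ fun A hA => ?_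
    simp_rw [hkey A hA]
    exact (hg.indicator (f.measurable hA)).add (hg'.indicator hA)
  have h1 : p.bind (fun x => g x • Measure.dirac (f x) + (1 - g x) • Measure.dirac x)
      = Measure.map f (p.withDensity g) + p.withDensity (fun x => 1 - g x) := by
    ext A hA
    rw [Measure.bind_apply hA hmeas.aemeasurable]
    simp_rw [hkey A hA]
    rw [lintegral_add_left (hg.indicator (f.measurable hA)), Measure.add_apply,
      Measure.map_apply f.measurable hA, withDensity_apply _ (f.measurable hA),
      withDensity_apply _ hA, lintegral_indicator (f.measurable hA), lintegral_indicator hA]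
  have h2 : p = p.withDensity g + p.withDensity (fun x => 1 - g x) := by
    rw [← withDensity_add_left hg]
    have : g + (fun x => 1 - g x) = 1 := by
      funext x
      exact add_tsub_cancel_of_le (hg1 x)
    rw [this, withDensity_one]
  have hle : ∀ A, p.withDensity (fun x => 1 - g x) A ≤ p A := by
    intro A
    conv_rhs => rw [h2]
    exact le_add_self
  rw [h1]
  constructor
  · intro h
    have h3 := h.trans h2
    refine Measure.ext_of_iUnion_eq_univ (iUnion_spanningSets p) fun n => ?_
    ext A hA
    rw [Measure.restrict_apply hA, Measure.restrict_apply hA]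
    have h4 := congrArg (fun m : Measure X => m (A ∩ spanningSets p n)) h3
    simp only [Measure.add_apply] at h4
    refine (ENNReal.add_left_inj ?_).1 h4
    exact (((hle _).trans (measure_mono Set.inter_subset_right)).trans_lt
      (measure_spanningSets_lt_top p n)).ne
  · intro h
    rw [h]
    exact h2.symm
end

section
/- Let X be a metric space, f : X ≃ₜ X a homeomorphism (with iterates f^k defined for all k ∈ ℤ via the group structure on homeomorphisms), and p, q : X → ℝ continuous functions with p(x) > 0 and q(x) > 0 for all x. Fix x₀ ∈ X and write x_k := f^k(x₀). Assume: (i) the orbit is returning, i.e. for every n ∈ ℤ, ⨅_{k∈ℕ} dist(x_{n+k+1}, x_n) = 0; (ii) the orbit is not periodic, i.e. x_k ≠ x₀ for every nonzero k ∈ ℤ. Then ⨅_{k∈ℤ} p(x_k)/q(x_k) = ⨅_{k∈ℕ} p(x_k)/q(x_k), where both infima are taken in ℝ (they exist since the ratios are bounded below by 0). -/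
lemma exists_ge_lt_of_iInf_eq_zero (F : ℕ → ℝ) (hpos : ∀ k, 0 < F k)
    (h : (⨅ k, F k) = 0) (N : ℕ) : ∀ δ > 0, ∃ k ≥ N, F k < δ := by
  induction N with
  | zero =>
    intro δ hδ
    obtain ⟨k, hk⟩ := exists_lt_of_ciInf_lt (h.trans_lt hδ)
    exact ⟨k, Nat.zero_le k, hk⟩
  | succ N ih =>
    intro δ hδ
    obtain ⟨k, hkN, hk⟩ := ih (min δ (F N)) (lt_min hδ (hpos N))
    refine ⟨k, ?_, hk.trans_le (min_le_left _ _)⟩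
    have hne : k ≠ N := by
      rintro rfl
      exact absurd (hk.trans_le (min_le_right _ _)) (lt_irrefl _)
    omega

/-- On a returning, aperiodic orbit `x_k = f^k x₀` of a homeomorphism `f` (iterates
taken via the group of self-equivalences), with `p, q` continuous positive
functions, the infimum of `p/q` over all integer iterates equals the infimum over
the nonnegative iterates. -/
theorem returning_orbit_iInf_eq_iInf_nat
    {X : Type*} [MetricSpace X] (f : X ≃ₜ X)
    (p q : X → ℝ) (hp : Continuous p) (hq : Continuous q)
    (hppos : ∀ x, 0 < p x) (hqpos : ∀ x, 0 < q x) (x₀ : X)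
    (hret : ∀ n : ℤ,
      (⨅ k : ℕ, dist ((f.toEquiv ^ (n + k + 1)) x₀) ((f.toEquiv ^ n) x₀)) = 0)
    (haper : ∀ k : ℤ, k ≠ 0 → (f.toEquiv ^ k) x₀ ≠ x₀) :
    (⨅ k : ℤ, p ((f.toEquiv ^ k) x₀) / q ((f.toEquiv ^ k) x₀)) =
      ⨅ k : ℕ, p ((f.toEquiv ^ (k : ℤ)) x₀) / q ((f.toEquiv ^ (k : ℤ)) x₀) := by
  have hinj : ∀ a b : ℤ, a ≠ b → (f.toEquiv ^ a) x₀ ≠ (f.toEquiv ^ b) x₀ := by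
    intro a b hab heq
    apply haper (a - b) (sub_ne_zero.mpr hab)
    have h1 : f.toEquiv ^ a = f.toEquiv ^ b * f.toEquiv ^ (a - b) := by
      rw [← zpow_add]; congr 1; ring
    rw [h1, Equiv.Perm.mul_apply] at heq
    exact (f.toEquiv ^ b).injective heq
  have hbdd : ∀ {ι : Type} (u : ι → X), BddBelow (Set.range fun k => p (u k) / q (u k)) := by
    intro ι u
    refine ⟨0, ?_⟩
    rintro _ ⟨k, rfl⟩
    exact (div_pos (hppos _) (hqpos _)).le
  have hg : Continuous fun x => p x / q x := hp.div hq fun x => (hqpos x).ne'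
  apply le_antisymm
  · exact le_ciInf fun k => ciInf_le (hbdd fun k : ℤ => (f.toEquiv ^ k) x₀) (k : ℤ)
  · refine le_ciInf fun n => le_of_forall_pos_le_add fun ε hε => ?_
    obtain ⟨δ, hδ, hd⟩ := Metric.continuous_iff.mp hg ((f.toEquiv ^ n) x₀) ε hε
    obtain ⟨k, hk, hlt⟩ := exists_ge_lt_of_iInf_eq_zero _
      (fun k : ℕ => dist_pos.mpr (hinj (n + k + 1) n (by omega))) (hret n) n.natAbs δ hδ
    have h2 := hd _ hlt
    rw [Real.dist_eq] at h2
    have h3 := (abs_lt.mp h2).2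
    obtain ⟨m, hm⟩ := Int.eq_ofNat_of_zero_le (show 0 ≤ n + k + 1 by omega)
    have h4 := ciInf_le (hbdd fun k : ℕ => (f.toEquiv ^ (k : ℤ)) x₀) m
    rw [hm] at h3
    linarith
end

section
/- Let X be a measurable space, p a σ-finite measure on X, f : X → X a measurable map with f ∘ f = id, and g : X → [0,∞] a measurable function with g(x) ≤ 1 for all x. Assume the invariance condition Measure.map f (p.withDensity g) = p.withDensity g. Then the escaping orbital kernel κ(x) = g(x)•δ_{f(x)} + (1 − g(x))•δ_x is reversible with respect to p: for all measurable sets A and B, ∫⁻_{x∈A} ( g(x)·𝟙_B(f(x)) + (1 − g(x))·𝟙_B(x) ) dp(x) = ∫⁻_{x∈B} ( g(x)·𝟙_A(f(x)) + (1 − g(x))·𝟙_A(x) ) dp(x). -/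
open MeasureTheory
open scoped ENNReal

/-- If `f` is a measurable involution and the escaping orbital kernel
`κ(x) = g(x)•δ_{f(x)} + (1 − g(x))•δ_x` leaves `p` invariant (expressed by
`map f (p.withDensity g) = p.withDensity g`), then the kernel is reversible
with respect to `p`. -/
theorem escaping_orbital_kernel_involution_reversible
    {X : Type*} [MeasurableSpace X] (p : Measure X) [SigmaFinite p]
    (f : X → X) (hf : Measurable f) (hinv : f ∘ f = id)
    (g : X → ℝ≥0∞) (hg : Measurable g) (hg1 : ∀ x, g x ≤ 1)
    (hinvariant : Measure.map f (p.withDensity g) = p.withDensity g) :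
    ∀ A B : Set X, MeasurableSet A → MeasurableSet B →
      ∫⁻ x in A, (g x * B.indicator (1 : X → ℝ≥0∞) (f x)
          + (1 - g x) * B.indicator (1 : X → ℝ≥0∞) x) ∂p =
        ∫⁻ x in B, (g x * A.indicator (1 : X → ℝ≥0∞) (f x)
          + (1 - g x) * A.indicator (1 : X → ℝ≥0∞) x) ∂p := by
  intro A B hA hB
  have key : ∀ (h : X → ℝ≥0∞) (S T : Set X), MeasurableSet S → MeasurableSet T →
      ∀ k : X → X, Measurable k →
      ∫⁻ x in S, h x * T.indicator (1 : X → ℝ≥0∞) (k x) ∂p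
        = p.withDensity h (k ⁻¹' T ∩ S) := by
    intro h S T hS hT k hk
    rw [withDensity_apply _ ((hk hT).inter hS), ← Measure.restrict_restrict (hk hT),
      ← lintegral_indicator (hk hT)]
    refine lintegral_congr fun x => ?_
    by_cases hx : k x ∈ T
    · have hx' : x ∈ k ⁻¹' T := hx
      simp [hx, Set.indicator_of_mem hx']
    · have hx' : x ∉ k ⁻¹' T := hx
      simp [hx, Set.indicator_of_notMem hx']
  have split : ∀ S T : Set X, MeasurableSet S → MeasurableSet T →
      ∫⁻ x in S, (g x * T.indicator (1 : X → ℝ≥0∞) (f x)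
          + (1 - g x) * T.indicator (1 : X → ℝ≥0∞) x) ∂p
        = p.withDensity g (f ⁻¹' T ∩ S) + p.withDensity (fun x => 1 - g x) (T ∩ S) := by
    intro S T hS hT
    have hm : Measurable (fun x => g x * T.indicator (1 : X → ℝ≥0∞) (f x)) :=
      hg.mul ((measurable_one.indicator hT).comp hf)
    rw [lintegral_add_left hm,
      key g S T hS hT f hf, key (fun x => 1 - g x) S T hS hT (fun x => x) measurable_id]
    rfl
  rw [split A B hA hB, split B A hB hA, Set.inter_comm B A]
  congr 1
  conv_lhs => rw [← hinvariant]
  rw [Measure.map_apply hf ((hf hB).inter hA), Set.preimage_inter, ← Set.preimage_comp, hinv,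
    Set.preimage_id, Set.inter_comm]
end

section
/- Let X be a metric space with its Borel σ-algebra, f : X ≃ₜ X a homeomorphism, g : X → ℝ a continuous function with 0 < g(x) ≤ 1 for all x, and p a Borel measure on X with full support (p(U) > 0 for every nonempty open set U). Assume the escaping orbital kernel κ(x) = g(x)•δ_{f(x)} + (1 − g(x))•δ_x leaves p invariant, and that it is reversible with respect to p: for all measurable sets A and B, ∫⁻_{x∈A} ( g(x)·𝟙_B(f(x)) + (1 − g(x))·𝟙_B(x) ) dp(x) = ∫⁻_{x∈B} ( g(x)·𝟙_A(f(x)) + (1 − g(x))·𝟙_A(x) ) dp(x). Then f is an involution: f(f(x)) = x for every x ∈ X. -/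
open MeasureTheory
open scoped ENNReal

/-- If the escaping orbital kernel `κ(x) = g(x)•δ_{f(x)} + (1 − g(x))•δ_x`, built
from a homeomorphism `f` and a continuous weight `0 < g ≤ 1`, leaves a fully
supported Borel measure `p` invariant and is reversible with respect to `p`,
then `f` is an involution. -/
theorem escaping_orbital_kernel_reversible_implies_involution
    {X : Type*} [MetricSpace X] [MeasurableSpace X] [BorelSpace X]
    (f : X ≃ₜ X) (g : X → ℝ) (hg : Continuous g)
    (hgpos : ∀ x, 0 < g x) (hg1 : ∀ x, g x ≤ 1)
    (p : Measure X)
    (hsupp : ∀ U : Set X, IsOpen U → U.Nonempty → 0 < p U)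
    (hinvariant : p.bind (fun x => ENNReal.ofReal (g x) • Measure.dirac (f x)
        + ENNReal.ofReal (1 - g x) • Measure.dirac x) = p)
    (hrev : ∀ A B : Set X, MeasurableSet A → MeasurableSet B →
      ∫⁻ x in A, (ENNReal.ofReal (g x) * B.indicator (1 : X → ℝ≥0∞) (f x)
          + ENNReal.ofReal (1 - g x) * B.indicator (1 : X → ℝ≥0∞) x) ∂p =
        ∫⁻ x in B, (ENNReal.ofReal (g x) * A.indicator (1 : X → ℝ≥0∞) (f x)
          + ENNReal.ofReal (1 - g x) * A.indicator (1 : X → ℝ≥0∞) x) ∂p) :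
    ∀ x : X, f (f x) = x := by
  intro x
  by_contra hx
  have hx1 : f x ≠ x := fun h => hx (by rw [h, h])
  obtain ⟨U1, W1, hU1, hW1, hxU1, hxW1, hd1⟩ := t2_separation hx1.symm
  obtain ⟨U2, W2, hU2, hW2, hxU2, hxW2, hd2⟩ := t2_separation (Ne.symm hx)
  let V : Set X := (U1 ∩ U2) ∩ (f ⁻¹' W1 ∩ (fun y => f (f y)) ⁻¹' W2)
  have hVo : IsOpen V := (hU1.inter hU2).inter
    ((hW1.preimage f.continuous).inter
      (hW2.preimage (f.continuous.comp f.continuous)))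
  have hxV : x ∈ V := ⟨⟨hxU1, hxU2⟩, hxW1, hxW2⟩
  have hV1 : ∀ y ∈ V, f y ∉ V := fun y hy hfy =>
    Set.disjoint_left.1 hd1 hfy.1.1 hy.2.1
  have hV2 : ∀ y ∈ V, f (f y) ∉ V := fun y hy hfy =>
    Set.disjoint_left.1 hd2 hfy.1.2 hy.2.2
  have hBo : IsOpen (f.symm ⁻¹' V) := hVo.preimage f.symm.continuous
  have h := hrev V (f.symm ⁻¹' V) hVo.measurableSet hBo.measurableSet
  have hR : ∫⁻ x in f.symm ⁻¹' V, (ENNReal.ofReal (g x) * V.indicator (1 : X → ℝ≥0∞) (f x)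
          + ENNReal.ofReal (1 - g x) * V.indicator (1 : X → ℝ≥0∞) x) ∂p = 0 := by
    rw [setLIntegral_congr_fun (g := fun _ => 0) hBo.measurableSet]
    · simp
    · intro y hy
      have h1 := hV1 _ hy
      have h2 := hV2 _ hy
      rw [f.apply_symm_apply] at h1 h2
      simp [Set.indicator_of_notMem h1, Set.indicator_of_notMem h2]
  rw [hR, lintegral_eq_zero_iff'] at h
  · have h3 : ∀ᵐ y ∂(p.restrict V), False := by
      filter_upwards [h, ae_restrict_mem hVo.measurableSet] with y hy hyV
      have hfy : f y ∈ f.symm ⁻¹' V := by simpa using hyV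
      have h4 := hgpos y
      rw [Set.indicator_of_mem hfy] at hy
      simp at hy
      linarith [hy.1]
    rw [ae_iff] at h3
    simp at h3
    exact (hsupp V hVo ⟨x, hxV⟩).ne' (by simp [h3])
  · have hm : Measurable ((f.symm ⁻¹' V).indicator (1 : X → ℝ≥0∞)) :=
      measurable_one.indicator hBo.measurableSet
    have hgm := hg.measurable
    have hfm := f.continuous.measurable
    exact ((hgm.ennreal_ofReal.mul (hm.comp hfm)).add
      ((measurable_const.sub hgm).ennreal_ofReal.mul hm)).aemeasurable
end

section
/- Let X be a measurable space, f : X → X a measurable map with f ∘ f = id, and p a measure on X. Then the measure p ⊓ Measure.map f p (the infimum of p and its pushforward under f in the lattice of measures on X) is invariant under f: Measure.map f ( p ⊓ Measure.map f p ) = p ⊓ Measure.map f p. -/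
open MeasureTheory

/-- For a measurable involution `f` and a measure `p`, the measure
`p ⊓ map f p` (infimum in the lattice of measures) is invariant under `f`. -/
theorem inf_map_involution_invariant
    {X : Type*} [MeasurableSpace X] (f : X → X) (hf : Measurable f)
    (hinv : f ∘ f = id) (p : Measure X) :
    Measure.map f (p ⊓ Measure.map f p) = p ⊓ Measure.map f p := by
  have hmm : ∀ q : Measure X, Measure.map f (Measure.map f q) = q := by
    intro q
    rw [Measure.map_map hf hf, hinv, Measure.map_id]
  have hle : Measure.map f (p ⊓ Measure.map f p) ≤ p ⊓ Measure.map f p := by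
    refine le_inf ?_ (Measure.map_mono inf_le_left hf)
    calc Measure.map f (p ⊓ Measure.map f p) ≤ Measure.map f (Measure.map f p) :=
          Measure.map_mono inf_le_right hf
      _ = p := hmm p
  refine le_antisymm hle ?_
  calc p ⊓ Measure.map f p = Measure.map f (Measure.map f (p ⊓ Measure.map f p)) := (hmm _).symm
    _ ≤ Measure.map f (p ⊓ Measure.map f p) := Measure.map_mono hle hf
end

section
/- Let X be a measurable space, λ a σ-finite measure on X, T a positive natural number, and f : X → X a measurable bijection with measurable inverse such that Measure.map f λ = λ and the T-fold iterate f^[T] equals the identity. Let ρ : X → [0,∞] be measurable and assume 0 < ∑_{j=0}^{T−1} ρ(f^[j](x)) < ∞ for every x. Let p := λ.withDensity ρ, and define the whole-orbit kernel κ(x) = ∑_{i=0}^{T−1} ω_i(x) • δ_{f^[i](x)}, where ω_i(x) = ρ(f^[i](x)) / ∑_{j=0}^{T−1} ρ(f^[j](x)). Then p.bind κ = p, i.e. ∫ κ(x)(A) dp(x) = p(A) for every measurable set A. -/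
open MeasureTheory
open scoped ENNReal

/-- Whole-orbit kernel on periodic orbits: if `f` preserves the σ-finite reference
measure `λ` and `f^[T] = id`, then the kernel that puts mass
`ρ(f^[i] x) / ∑_{j<T} ρ(f^[j] x)` on each orbit point `f^[i] x` leaves the target
`p = λ.withDensity ρ` invariant. -/
theorem whole_orbit_kernel_invariant
    {X : Type*} [MeasurableSpace X] (lam : Measure X) [SigmaFinite lam]
    (T : ℕ) (hT : 0 < T) (f : X ≃ᵐ X)
    (hmap : Measure.map f lam = lam) (hper : (⇑f)^[T] = id)
    (ρ : X → ℝ≥0∞) (hρ : Measurable ρ)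
    (hpos : ∀ x, 0 < ∑ j ∈ Finset.range T, ρ ((⇑f)^[j] x))
    (hfin : ∀ x, ∑ j ∈ Finset.range T, ρ ((⇑f)^[j] x) < ⊤) :
    (lam.withDensity ρ).bind
        (fun x => ∑ i ∈ Finset.range T,
          (ρ ((⇑f)^[i] x) / ∑ j ∈ Finset.range T, ρ ((⇑f)^[j] x)) •
            Measure.dirac ((⇑f)^[i] x)) =
      lam.withDensity ρ := by
  have hfm : ∀ i, Measurable ((⇑f)^[i]) := fun i => f.measurable.iterate i
  have hmp : ∀ i, MeasurePreserving ((⇑f)^[i]) lam lam := fun i =>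
    MeasurePreserving.iterate ⟨f.measurable, hmap⟩ i
  set S : X → ℝ≥0∞ := fun x => ∑ j ∈ Finset.range T, ρ ((⇑f)^[j] x) with hS
  have hSm : Measurable S :=
    Finset.measurable_fun_sum _ fun j _ => hρ.comp (hfm j)
  have hSf : ∀ x, S (f x) = S x := by
    intro x
    have h1 := Finset.sum_range_succ (fun j => ρ ((⇑f)^[j] x)) T
    have h2 := Finset.sum_range_succ' (fun j => ρ ((⇑f)^[j] x)) T
    have h0 : ρ x ≠ ⊤ := by
      have : ρ ((⇑f)^[0] x) ≤ S x :=
        Finset.single_le_sum (f := fun j => ρ ((⇑f)^[j] x)) (fun _ _ => zero_le)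
          (Finset.mem_range.2 hT)
      exact (this.trans_lt (hfin x)).ne
    rw [h1] at h2
    simp only [hper, id, Function.iterate_zero, Function.iterate_succ_apply] at h2
    exact ((ENNReal.add_left_inj h0).1 h2).symm
  have hSi : ∀ i x, S ((⇑f)^[i] x) = S x := by
    intro i
    induction i with
    | zero => intro x; rfl
    | succ n ih => intro x; rw [Function.iterate_succ_apply, ih, hSf]
  have hκ : Measurable (fun x => ∑ i ∈ Finset.range T,
      (ρ ((⇑f)^[i] x) / S x) • Measure.dirac ((⇑f)^[i] x)) := by
    refine Measure.measurable_of_measurable_coe _ fun A hA => ?_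
    simp only [Measure.finsetSum_apply, Measure.smul_apply, smul_eq_mul,
      Measure.dirac_apply' _ hA]
    refine Finset.measurable_fun_sum _ fun i _ => ?_
    exact ((hρ.comp (hfm i)).div hSm).mul
      ((measurable_one.indicator hA).comp (hfm i))
  ext A hA
  rw [Measure.bind_apply hA hκ.aemeasurable]
  set h : X → ℝ≥0∞ := fun x => ρ x / S x * A.indicator 1 x with hh
  have hhm : Measurable h := (hρ.div hSm).mul (measurable_one.indicator hA)
  have e1 : ∀ x, (∑ i ∈ Finset.range T,
      (ρ ((⇑f)^[i] x) / S x) • Measure.dirac ((⇑f)^[i] x)) A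
      = ∑ i ∈ Finset.range T, h ((⇑f)^[i] x) := by
    intro x
    simp only [Measure.finsetSum_apply, Measure.smul_apply, smul_eq_mul,
      Measure.dirac_apply' _ hA, hh, hSi]
  have hsm : Measurable (fun x => ∑ i ∈ Finset.range T, h ((⇑f)^[i] x)) :=
    Finset.measurable_fun_sum _ fun i _ => hhm.comp (hfm i)
  simp only [e1]
  rw [lintegral_withDensity_eq_lintegral_mul _ hρ hsm, withDensity_apply _ hA,
    ← lintegral_indicator hA]
  simp only [Pi.mul_apply, Finset.mul_sum]
  have m1 : ∀ i, Measurable (fun x => ρ x * h ((⇑f)^[i] x)) := fun i =>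
    hρ.mul (hhm.comp (hfm i))
  have m2 : ∀ i, Measurable (fun x => ρ ((⇑f)^[T - 1 - i] (f x)) * h x) := fun i =>
    (hρ.comp ((hfm _).comp f.measurable)).mul hhm
  rw [lintegral_finsetSum _ fun i _ => m1 i]
  have e2 : ∀ i ∈ Finset.range T, ∫⁻ x, ρ x * h ((⇑f)^[i] x) ∂lam
      = ∫⁻ x, ρ ((⇑f)^[T - 1 - i] (f x)) * h x ∂lam := by
    intro i hi
    have hi := Finset.mem_range.1 hi
    rw [← (hmp (T - 1 - i + 1)).lintegral_comp (m1 i)]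
    refine lintegral_congr fun x => ?_
    rw [← Function.iterate_add_apply, ← Function.iterate_succ_apply,
      show i + (T - 1 - i + 1) = T by omega, hper]
    rfl
  rw [Finset.sum_congr rfl e2, ← lintegral_finsetSum _ fun i _ => m2 i]
  refine lintegral_congr fun x => ?_
  rw [← Finset.sum_mul, Finset.sum_range_reflect (fun j => ρ ((⇑f)^[j] (f x))) T]
  change S (f x) * h x = _
  rw [hSf, hh]
  by_cases hx : x ∈ A
  · simp only [Set.indicator_of_mem hx, Pi.one_apply, mul_one]
    exact ENNReal.mul_div_cancel (hpos x).ne' (hfin x).ne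
  · simp [Set.indicator_of_notMem hx]
end

section
/- Let g : ℕ → ℝ satisfy 0 < g(i) ≤ 1 for all i. Define weights ω : ℕ → ℕ → ℝ by ω(0)(0) = 1 and ω(0)(i) = 0 for i ≥ 1, with the recurrence ω(t+1)(0) = (1 − g(0))·ω(t)(0) and ω(t+1)(i+1) = (1 − g(i+1))·ω(t)(i+1) + g(i)·ω(t)(i). Then for every i ∈ ℕ: (i) the cumulative sums converge, lim_{n→∞} ∑_{t=0}^{n} ω(t)(i) = 1/g(i); and (ii) the time averages vanish, lim_{n→∞} (1/n)·∑_{t=0}^{n−1} ω(t)(i) = 0. -/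
open Filter

lemma hasSum_aux (a b : ℕ → ℝ) (c : ℝ) (hc : 0 < c) (ha : ∀ n, 0 ≤ a n)
    (hb1 : ∀ n, b n ≤ 1) (hb : Tendsto b atTop (nhds 1))
    (h : ∀ n, c * ∑ t ∈ Finset.range n, a t = b n - a n) : HasSum a (1 / c) := by
  have hs : Summable a := by
    refine summable_of_sum_range_le (c := 1 / c) ha fun n => ?_
    rw [le_div_iff₀ hc]
    have := h n
    have := ha n
    have := hb1 n
    linarith
  have h0 := hs.tendsto_atTop_zero
  rw [hasSum_iff_tendsto_nat_of_nonneg ha]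
  have h2 := (hb.sub h0).div_const c
  rw [sub_zero] at h2
  refine h2.congr fun n => ?_
  rw [← h n]
  field_simp

/-- Evolution of a point mass under the escaping orbital kernel on an aperiodic
orbit: the cumulative sums of the weights at orbit point `i` converge to
`1 / g i`, while the time averages converge to `0`. -/
theorem escaping_orbital_aperiodic_weights
    (g : ℕ → ℝ) (hgpos : ∀ i, 0 < g i) (hg1 : ∀ i, g i ≤ 1)
    (ω : ℕ → ℕ → ℝ)
    (hω00 : ω 0 0 = 1) (hω0 : ∀ i, ω 0 (i + 1) = 0)
    (hrec0 : ∀ t, ω (t + 1) 0 = (1 - g 0) * ω t 0)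
    (hrec : ∀ t i, ω (t + 1) (i + 1) = (1 - g (i + 1)) * ω t (i + 1) + g i * ω t i) :
    ∀ i : ℕ,
      Tendsto (fun n => ∑ t ∈ Finset.range (n + 1), ω t i) atTop (nhds (1 / g i)) ∧
      Tendsto (fun n : ℕ => (1 / (n : ℝ)) * ∑ t ∈ Finset.range n, ω t i)
        atTop (nhds 0) := by
  have hnn : ∀ t i, 0 ≤ ω t i := by
    intro t
    induction t with
    | zero =>
      intro i
      cases i with
      | zero => rw [hω00]; exact zero_le_one
      | succ i => rw [hω0]
    | succ t ih =>
      intro i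
      cases i with
      | zero =>
        rw [hrec0]
        exact mul_nonneg (sub_nonneg.2 (hg1 0)) (ih 0)
      | succ i =>
        rw [hrec]
        exact add_nonneg (mul_nonneg (sub_nonneg.2 (hg1 _)) (ih _))
          (mul_nonneg (hgpos i).le (ih i))
  have key : ∀ i, HasSum (fun t => ω t i) (1 / g i) := by
    intro i
    induction i with
    | zero =>
      refine hasSum_aux _ (fun _ => 1) _ (hgpos 0) (fun n => hnn n 0) (fun _ => le_rfl)
        tendsto_const_nhds fun n => ?_
      induction n with
      | zero => simp [hω00]
      | succ n ih =>
        rw [Finset.sum_range_succ, mul_add, ih, hrec0]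
        ring
    | succ i ih =>
      refine hasSum_aux _ (fun n => g i * ∑ t ∈ Finset.range n, ω t i) _ (hgpos (i + 1))
        (fun n => hnn n (i + 1)) (fun n => ?_) ?_ fun n => ?_
      · have h := sum_le_hasSum (Finset.range n) (fun t _ => hnn t i) ih
        rw [le_div_iff₀ (hgpos i)] at h
        linarith
      · have h := ih.tendsto_sum_nat.const_mul (g i)
        rwa [mul_one_div_cancel (hgpos i).ne'] at h
      · induction n with
        | zero => simp [hω0]
        | succ n ihn =>
          rw [Finset.sum_range_succ, mul_add, ihn, hrec, Finset.sum_range_succ]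
          ring
  intro i
  have h := (key i).tendsto_sum_nat
  refine ⟨(tendsto_add_atTop_iff_nat 1).2 h, ?_⟩
  have h2 := (tendsto_one_div_atTop_nhds_zero_nat (𝕜 := ℝ)).mul h
  rwa [zero_mul] at h2
end

section
/- Let T be a positive natural number and g : ZMod T → ℝ with 0 < g(i) ≤ 1 for all i. Define weights ω : ℕ → ZMod T → ℝ by ω(0)(0) = 1, ω(0)(i) = 0 for i ≠ 0, and the recurrence ω(t+1)(i) = (1 − g(i))·ω(t)(i) + g(i−1)·ω(t)(i−1), where indices are taken in ZMod T. Then for every i ∈ ZMod T, the time averages converge: lim_{n→∞} (1/n)·∑_{t=0}^{n−1} ω(t)(i) = (1/g(i)) / ( ∑_{j ∈ ZMod T} 1/g(j) ). -/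
open Filter

/-- Evolution of a point mass under the escaping orbital kernel on a periodic
orbit of period `T`: the time averages of the weight at orbit point `i` converge
to `(1 / g i) / ∑ j, 1 / g j`. -/
theorem escaping_orbital_periodic_time_average
    (T : ℕ) [NeZero T] (g : ZMod T → ℝ) (hgpos : ∀ i, 0 < g i) (hg1 : ∀ i, g i ≤ 1)
    (ω : ℕ → ZMod T → ℝ)
    (hω00 : ω 0 0 = 1) (hω0 : ∀ i : ZMod T, i ≠ 0 → ω 0 i = 0)
    (hrec : ∀ t (i : ZMod T),
      ω (t + 1) i = (1 - g i) * ω t i + g (i - 1) * ω t (i - 1)) :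
    ∀ i : ZMod T,
      Tendsto (fun n : ℕ => (1 / (n : ℝ)) * ∑ t ∈ Finset.range n, ω t i)
        atTop (nhds ((1 / g i) / ∑ j : ZMod T, 1 / g j)) := by
  have hnn : ∀ t i, 0 ≤ ω t i := by
    intro t
    induction t with
    | zero =>
      intro i
      by_cases h : i = 0
      · rw [h, hω00]; exact zero_le_one
      · rw [hω0 i h]
    | succ t ih =>
      intro i
      rw [hrec]
      exact add_nonneg (mul_nonneg (by linarith [hg1 i]) (ih i))
        (mul_nonneg (hgpos _).le (ih _))
  have hsum : ∀ t, ∑ i, ω t i = 1 := by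
    intro t
    induction t with
    | zero =>
      rw [Finset.sum_eq_single (0 : ZMod T) (fun i _ h => hω0 i h) (by simp), hω00]
    | succ t ih =>
      have h1 : ∑ i : ZMod T, g (i - 1) * ω t (i - 1) = ∑ i : ZMod T, g i * ω t i :=
        (Equiv.subRight (1 : ZMod T)).sum_comp (fun i => g i * ω t i)
      simp only [hrec, Finset.sum_add_distrib, h1]
      rw [← Finset.sum_add_distrib]
      refine Eq.trans ?_ ih
      exact Finset.sum_congr rfl (fun i _ => by ring)
  have hle : ∀ t i, ω t i ≤ 1 := by
    intro t i
    rw [← hsum t]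
    exact Finset.single_le_sum (fun j _ => hnn t j) (Finset.mem_univ i)
  let A : ℕ → ZMod T → ℝ := fun n i => (1 / (n : ℝ)) * ∑ t ∈ Finset.range n, ω t i
  have htel : ∀ n i, g (i - 1) * ∑ t ∈ Finset.range n, ω t (i - 1)
      - g i * ∑ t ∈ Finset.range n, ω t i = ω n i - ω 0 i := by
    intro n i
    rw [← Finset.sum_range_sub (fun t => ω t i) n, Finset.mul_sum, Finset.mul_sum,
      ← Finset.sum_sub_distrib]
    exact Finset.sum_congr rfl (fun t _ => by rw [hrec]; ring)
  have hstep : ∀ i, Tendsto (fun n => g (i - 1) * A n (i - 1) - g i * A n i) atTop (nhds 0) := by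
    intro i
    refine squeeze_zero_norm (a := fun n : ℕ => 1 / (n : ℝ)) ?_ tendsto_one_div_atTop_nhds_zero_nat
    intro n
    have e : g (i - 1) * A n (i - 1) - g i * A n i = (1 / (n : ℝ)) * (ω n i - ω 0 i) := by
      rw [← htel n i]; simp only [A]; ring
    have hn : (0 : ℝ) ≤ 1 / (n : ℝ) := by positivity
    rw [e, Real.norm_eq_abs, abs_mul, abs_of_nonneg hn]
    refine mul_le_of_le_one_right hn ?_
    rw [abs_le]
    constructor <;> linarith [hnn n i, hnn 0 i, hle n i, hle 0 i]
  have hzero : ∀ k : ℕ, Tendsto (fun n => g 0 * A n 0 - g (k : ZMod T) * A n (k : ZMod T))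
      atTop (nhds 0) := by
    intro k
    induction k with
    | zero => simp
    | succ k ih =>
      have h := ih.add (hstep ((k + 1 : ℕ) : ZMod T))
      have e : ((k + 1 : ℕ) : ZMod T) - 1 = (k : ZMod T) := by push_cast; ring
      rw [e, add_zero] at h
      exact h.congr (fun n => by ring)
  have hzero' : ∀ j : ZMod T, Tendsto (fun n => g 0 * A n 0 - g j * A n j) atTop (nhds 0) := by
    intro j
    have h := hzero j.val
    rwa [ZMod.natCast_zmod_val] at h
  have hij : ∀ i j : ZMod T, Tendsto (fun n => g i * A n i - g j * A n j) atTop (nhds 0) := by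
    intro i j
    have h := (hzero' j).sub (hzero' i)
    rw [sub_zero] at h
    exact h.congr (fun n => by ring)
  intro i
  have hG : 0 < ∑ j : ZMod T, 1 / g j :=
    Finset.sum_pos (fun j _ => one_div_pos.mpr (hgpos j)) Finset.univ_nonempty
  have hA : ∀ n : ℕ, 0 < n → ∑ j, A n j = 1 := by
    intro n hn
    simp only [A]
    rw [← Finset.mul_sum, Finset.sum_comm]
    simp only [hsum]
    have : (n : ℝ) ≠ 0 := by positivity
    simp [this]
  have hlim : Tendsto (fun n => ∑ j, (1 / g j) * (g i * A n i - g j * A n j)) atTop (nhds 0) := by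
    have h := tendsto_finsetSum Finset.univ
      (fun (j : ZMod T) _ => (hij i j).const_mul (1 / g j))
    simpa using h
  have h2 := ((hlim.add_const 1).const_mul ((1 / g i) / ∑ j : ZMod T, 1 / g j))
  rw [zero_add, mul_one] at h2
  refine h2.congr' ?_
  filter_upwards [eventually_gt_atTop 0] with n hn
  have e : ∑ j, (1 / g j) * (g i * A n i - g j * A n j)
      = (∑ j, 1 / g j) * (g i * A n i) - 1 := by
    refine Eq.trans ?_ (congrArg (fun x => (∑ j, 1 / g j) * (g i * A n i) - x) (hA n hn))
    rw [Finset.sum_mul, ← Finset.sum_sub_distrib]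
    refine Finset.sum_congr rfl (fun j _ => ?_)
    have := (hgpos j).ne'
    field_simp
  rw [e]
  change _ = A n i
  have h3 := (hgpos i).ne'
  have h4 := hG.ne'
  generalize (∑ j : ZMod T, 1 / g j) = G at h4 ⊢
  field_simp
  ring
end

section
/- Let n be a natural number and g : Fin n → ℝ with 0 < g(i) ≤ 1 for all i. Then ∑'_{t : Fin n → ℕ} ( (∑_{i} (t(i) + 1)) · ∏_{i} g(i)·(1 − g(i))^{t(i)} ) = ∑_{i} 1/g(i), where the left-hand side is the (unconditional) sum over all functions t : Fin n → ℕ, the inner sum and product range over i ∈ Fin n, and t(i) is interpreted as a real number in the factor (t(i)+1). -/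
theorem hasSum_mul_nonneg {α β : Type*} {u : α → ℝ} {v : β → ℝ} {a b : ℝ}
    (hu : HasSum u a) (hv : HasSum v b) (hu0 : ∀ x, 0 ≤ u x) (hv0 : ∀ x, 0 ≤ v x) :
    HasSum (fun p : α × β => u p.1 * v p.2) (a * b) :=
  hu.mul hv (hu.summable.mul_of_nonneg hv.summable hu0 hv0)

theorem escape_aux (n : ℕ) : ∀ (g : Fin n → ℝ), (∀ i, 0 < g i) → (∀ i, g i ≤ 1) →
    HasSum (fun t : Fin n → ℕ => ∏ i, g i * (1 - g i) ^ (t i)) 1 ∧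
    HasSum (fun t : Fin n → ℕ =>
      (∑ i, ((t i : ℝ) + 1)) * ∏ i, g i * (1 - g i) ^ (t i)) (∑ i, 1 / g i) := by
  induction n with
  | zero =>
    intro g _ _
    constructor
    · simpa using hasSum_unique (fun t : Fin 0 → ℕ => (1 : ℝ))
    · simpa using (hasSum_zero : HasSum (fun t : Fin 0 → ℕ => (0 : ℝ)) 0)
  | succ n ih =>
    intro g h0 h1
    obtain ⟨hP, hS⟩ := ih (fun i => g i.succ) (fun i => h0 _) (fun i => h1 _)
    have hr0 : 0 ≤ 1 - g 0 := sub_nonneg.2 (h1 0)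
    have hr1 : 1 - g 0 < 1 := by linarith [h0 0]
    have hg : g 0 ≠ 0 := (h0 0).ne'
    have hA : HasSum (fun k : ℕ => g 0 * (1 - g 0) ^ k) 1 := by
      have h := (hasSum_geometric_of_lt_one hr0 hr1).mul_left (g 0)
      have e : g 0 * (1 - (1 - g 0))⁻¹ = 1 := by
        rw [sub_sub_cancel, mul_inv_cancel₀ hg]
      rwa [e] at h
    have hB : HasSum (fun k : ℕ => ((k : ℝ) + 1) * (g 0 * (1 - g 0) ^ k)) (1 / g 0) := by
      have hn : ‖1 - g 0‖ < 1 := by rwa [Real.norm_of_nonneg hr0]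
      have h := ((hasSum_coe_mul_geometric_of_norm_lt_one hn).mul_left (g 0)).add hA
      have e : g 0 * ((1 - g 0) / (1 - (1 - g 0)) ^ 2) + 1 = 1 / g 0 := by
        rw [sub_sub_cancel]; field_simp; ring
      rw [e] at h
      have e2 : (fun k : ℕ => ((k : ℝ) + 1) * (g 0 * (1 - g 0) ^ k)) =
          fun k : ℕ => g 0 * ((k : ℝ) * (1 - g 0) ^ k) + g 0 * (1 - g 0) ^ k := by
        funext k
        ring
      rw [e2]
      exact h
    have hA0 : ∀ k : ℕ, 0 ≤ g 0 * (1 - g 0) ^ k := fun k =>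
      mul_nonneg (h0 0).le (pow_nonneg hr0 k)
    have hB0 : ∀ k : ℕ, 0 ≤ ((k : ℝ) + 1) * (g 0 * (1 - g 0) ^ k) := fun k =>
      mul_nonneg (by positivity) (hA0 k)
    have hP0 : ∀ t : Fin n → ℕ, 0 ≤ ∏ i, g (Fin.succ i) * (1 - g (Fin.succ i)) ^ (t i) :=
      fun t => Finset.prod_nonneg fun i _ =>
        mul_nonneg (h0 _).le (pow_nonneg (sub_nonneg.2 (h1 _)) _)
    have hS0 : ∀ t : Fin n → ℕ, 0 ≤ (∑ i, ((t i : ℝ) + 1)) *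
        ∏ i, g (Fin.succ i) * (1 - g (Fin.succ i)) ^ (t i) :=
      fun t => mul_nonneg (Finset.sum_nonneg fun i _ => by positivity) (hP0 t)
    constructor
    · rw [← (Fin.consEquiv fun _ => ℕ).hasSum_iff]
      have h := hasSum_mul_nonneg hA hP hA0 hP0
      rw [one_mul] at h
      convert h using 1
      funext p
      simp [Fin.prod_univ_succ, Fin.consEquiv]
    · rw [← (Fin.consEquiv fun _ => ℕ).hasSum_iff]
      have h := (hasSum_mul_nonneg hB hP hB0 hP0).add (hasSum_mul_nonneg hA hS hA0 hS0)
      rw [mul_one, one_mul] at h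
      rw [Fin.sum_univ_succ]
      convert h using 1
      funext p
      simp only [Function.comp, Fin.prod_univ_succ, Fin.sum_univ_succ, Fin.consEquiv,
        Equiv.coe_fn_mk, Fin.cons_zero, Fin.cons_succ]
      ring


/-- Average escape time of the escaping orbital kernel: with acceptance
probabilities `g i ∈ (0,1]` and `t i` counting the rejections at orbit point `i`,
the expected number of iterations until the first acceptance of the `n`-th point
is `∑ i, 1 / g i`. -/
theorem average_escape_time
    (n : ℕ) (g : Fin n → ℝ) (hgpos : ∀ i, 0 < g i) (hg1 : ∀ i, g i ≤ 1) :
    (∑' t : Fin n → ℕ,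
        (∑ i, ((t i : ℝ) + 1)) * ∏ i, g i * (1 - g i) ^ (t i)) =
      ∑ i, 1 / g i := by
  exact (escape_aux n g hgpos hg1).2.tsum_eq
end

section
/- Let X be a measurable space, p a σ-finite measure on X, f : X → X a measurable bijection with measurable inverse f⁻¹, and g⁺, g⁻ : X → [0,∞] measurable functions with g⁺(x) + g⁻(x) ≤ 1 for all x. Assume the balance condition Measure.map f (p.withDensity g⁺) = p.withDensity g⁻. Then the diffusing orbital kernel κ(x) = g⁺(x)•δ_{f(x)} + g⁻(x)•δ_{f⁻¹(x)} + (1 − g⁺(x) − g⁻(x))•δ_x leaves p invariant: p.bind κ = p, i.e. ∫ κ(x)(A) dp(x) = p(A) for every measurable set A. -/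
open MeasureTheory
open scoped ENNReal

/-- The diffusing orbital kernel
`κ(x) = g⁺(x)•δ_{f(x)} + g⁻(x)•δ_{f⁻¹(x)} + (1 − g⁺(x) − g⁻(x))•δ_x` leaves the
σ-finite measure `p` invariant whenever the balance condition
`map f (p.withDensity g⁺) = p.withDensity g⁻` holds. -/
theorem diffusing_orbital_kernel_invariant
    {X : Type*} [MeasurableSpace X] (p : Measure X) [SigmaFinite p]
    (f : X ≃ᵐ X) (gp gm : X → ℝ≥0∞) (hgp : Measurable gp) (hgm : Measurable gm)
    (hsum : ∀ x, gp x + gm x ≤ 1)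
    (hbal : Measure.map f (p.withDensity gp) = p.withDensity gm) :
    p.bind (fun x => gp x • Measure.dirac (f x) + gm x • Measure.dirac (f.symm x)
        + (1 - gp x - gm x) • Measure.dirac x) = p := by
  have key : ∀ (g : X → ℝ≥0∞) (h : X → X) (A : Set X), Measurable g → Measurable h →
      MeasurableSet A →
      ∫⁻ x, g x * Set.indicator A 1 (h x) ∂p = p.withDensity g (h ⁻¹' A) := by
    intro g h A hg hh hA
    rw [withDensity_apply _ (hh hA), ← lintegral_indicator (hh hA)]
    congr 1
    funext x
    by_cases hx : h x ∈ A <;> simp [Set.indicator, hx]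
  have hind : ∀ (h : X → X) (A : Set X), Measurable h → MeasurableSet A →
      Measurable (fun x => (Set.indicator A 1 (h x) : ℝ≥0∞)) := by
    intro h A hh hA
    exact (measurable_one.indicator hA).comp hh
  have hg0 : Measurable (fun x => 1 - gp x - gm x) :=
    (measurable_const.sub hgp).sub hgm
  have hmeas : Measurable (fun x => gp x • Measure.dirac (f x)
      + gm x • Measure.dirac (f.symm x) + (1 - gp x - gm x) • Measure.dirac x) := by
    refine Measure.measurable_of_measurable_coe _ fun A hA => ?_
    simp only [Measure.add_apply, Measure.smul_apply, smul_eq_mul, Measure.dirac_apply' _ hA]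
    exact ((hgp.mul (hind _ A f.measurable hA)).add
      (hgm.mul (hind _ A f.symm.measurable hA))).add (hg0.mul (hind _ A measurable_id hA))
  ext A hA
  rw [Measure.bind_apply hA hmeas.aemeasurable]
  simp only [Measure.add_apply, Measure.smul_apply, smul_eq_mul, Measure.dirac_apply' _ hA]
  have m1 : Measurable (fun x => gp x * (Set.indicator A 1 (f x) : ℝ≥0∞)) := hgp.mul (hind _ A f.measurable hA)
  have m2 : Measurable (fun x => gm x * (Set.indicator A 1 (f.symm x) : ℝ≥0∞)) := hgm.mul (hind _ A f.symm.measurable hA)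
  have m12 : Measurable (fun x => gp x * (Set.indicator A 1 (f x) : ℝ≥0∞)
      + gm x * (Set.indicator A 1 (f.symm x) : ℝ≥0∞)) := m1.add m2
  have m0 : Measurable (fun x => gm x + gp x) := hgm.add hgp
  rw [lintegral_add_left m12, lintegral_add_left m1,
    key gp f A hgp f.measurable hA, key gm f.symm A hgm f.symm.measurable hA]
  have h3 := key _ id A hg0 measurable_id hA
  simp only [id, Set.preimage_id] at h3
  have h1 : p.withDensity gp (f ⁻¹' A) = p.withDensity gm A := by
    rw [← hbal, Measure.map_apply f.measurable hA]
  have h2 : p.withDensity gm (f.symm ⁻¹' A) = p.withDensity gp A := by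
    rw [← hbal, Measure.map_apply f.measurable (f.symm.measurable hA), ← Set.preimage_comp]
    simp
  rw [h3, h1, h2, withDensity_apply _ hA, withDensity_apply _ hA, withDensity_apply _ hA,
    ← lintegral_add_left hgm, ← lintegral_add_left m0]
  have : ∀ x, gm x + gp x + (1 - gp x - gm x) = 1 := by
    intro x
    rw [tsub_tsub, add_comm (gm x)]
    exact add_tsub_cancel_of_le (hsum x)
  simp [this]
end

section
/- Let X be a measurable space, p a σ-finite measure on X, f : X → X a measurable bijection with measurable inverse f⁻¹, and g⁺, g⁻ : X → [0,∞] measurable functions with g⁺(x) + g⁻(x) ≤ 1 for all x. Assume the balance condition Measure.map f (p.withDensity g⁺) = p.withDensity g⁻. Then the diffusing orbital kernel κ(x) = g⁺(x)•δ_{f(x)} + g⁻(x)•δ_{f⁻¹(x)} + (1 − g⁺(x) − g⁻(x))•δ_x is reversible with respect to p: for all measurable sets A and B, ∫⁻_{x∈A} ( g⁺(x)·𝟙_B(f(x)) + g⁻(x)·𝟙_B(f⁻¹(x)) + (1 − g⁺(x) − g⁻(x))·𝟙_B(x) ) dp(x) = ∫⁻_{x∈B} ( g⁺(x)·𝟙_A(f(x))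 + g⁻(x)·𝟙_A(f⁻¹(x)) + (1 − g⁺(x) − g⁻(x))·𝟙_A(x) ) dp(x). -/
open MeasureTheory
open scoped ENNReal

theorem aux_term {X : Type*} [MeasurableSpace X] (p : Measure X) (g : X → ℝ≥0∞) (h : X → X)
    (hh : Measurable h) (A B : Set X) (hA : MeasurableSet A) (hB : MeasurableSet B) :
    ∫⁻ x in A, g x * B.indicator (1 : X → ℝ≥0∞) (h x) ∂p = p.withDensity g (A ∩ h ⁻¹' B) := by
  rw [withDensity_apply _ (hA.inter (hh hB)), ← lintegral_indicator hA,
    ← lintegral_indicator (hA.inter (hh hB))]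
  congr 1
  ext x
  by_cases h1 : x ∈ A <;> by_cases h2 : h x ∈ B <;> simp [Set.indicator, h1, h2]

/-- Under the balance condition `map f (p.withDensity g⁺) = p.withDensity g⁻`,
the diffusing orbital kernel
`κ(x) = g⁺(x)•δ_{f(x)} + g⁻(x)•δ_{f⁻¹(x)} + (1 − g⁺(x) − g⁻(x))•δ_x`
is reversible with respect to `p`. -/
theorem diffusing_orbital_kernel_reversible
    {X : Type*} [MeasurableSpace X] (p : Measure X) [SigmaFinite p]
    (f : X ≃ᵐ X) (gp gm : X → ℝ≥0∞) (hgp : Measurable gp) (hgm : Measurable gm)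
    (hsum : ∀ x, gp x + gm x ≤ 1)
    (hbal : Measure.map f (p.withDensity gp) = p.withDensity gm) :
    ∀ A B : Set X, MeasurableSet A → MeasurableSet B →
      ∫⁻ x in A, (gp x * B.indicator (1 : X → ℝ≥0∞) (f x)
          + gm x * B.indicator (1 : X → ℝ≥0∞) (f.symm x)
          + (1 - gp x - gm x) * B.indicator (1 : X → ℝ≥0∞) x) ∂p =
        ∫⁻ x in B, (gp x * A.indicator (1 : X → ℝ≥0∞) (f x)
          + gm x * A.indicator (1 : X → ℝ≥0∞) (f.symm x)
          + (1 - gp x - gm x) * A.indicator (1 : X → ℝ≥0∞) x) ∂p := by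
  have hsplit : ∀ A B : Set X, MeasurableSet A → MeasurableSet B →
      ∫⁻ x in A, (gp x * B.indicator (1 : X → ℝ≥0∞) (f x)
          + gm x * B.indicator (1 : X → ℝ≥0∞) (f.symm x)
          + (1 - gp x - gm x) * B.indicator (1 : X → ℝ≥0∞) x) ∂p =
        p.withDensity gp (A ∩ f ⁻¹' B) + p.withDensity gp (B ∩ f ⁻¹' A)
          + p.withDensity (fun x => 1 - gp x - gm x) (A ∩ B) := by
    intro A B hA hB
    have hi : Measurable (B.indicator (1 : X → ℝ≥0∞)) := measurable_one.indicator hB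
    have m1 : Measurable fun x => gp x * B.indicator (1 : X → ℝ≥0∞) (f x) :=
      hgp.mul (hi.comp f.measurable)
    have m2 : Measurable fun x => gm x * B.indicator (1 : X → ℝ≥0∞) (f.symm x) :=
      hgm.mul (hi.comp f.symm.measurable)
    have m3 : Measurable fun x => gp x * B.indicator (1 : X → ℝ≥0∞) (f x)
        + gm x * B.indicator (1 : X → ℝ≥0∞) (f.symm x) := m1.add m2
    have h3 := aux_term p (fun x => 1 - gp x - gm x) id measurable_id A B hA hB
    simp only [id, Set.preimage_id] at h3
    rw [lintegral_add_left m3, lintegral_add_left m1,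
      aux_term p gp f f.measurable A B hA hB, aux_term p gm f.symm f.symm.measurable A B hA hB,
      h3, ← hbal, f.map_apply]
    congr 3
    ext x
    simp [and_comm]
  intro A B hA hB
  rw [hsplit A B hA hB, hsplit B A hB hA, Set.inter_comm A B,
    add_comm (p.withDensity gp (A ∩ f ⁻¹' B))]
end

section
/- Let a : ℤ → ℝ satisfy a(k) > 0 for all k. Define c := ⨅_{k∈ℤ} ( a(k+1) + a(k−1) )⁻¹ and c' := (1/2)·⨅_{k∈ℤ} a(k)⁻¹, both infima taken in ℝ (they exist since the terms are bounded below by 0). Set g⁺(k) := c·a(k+1) and g⁻(k) := c·a(k−1). Then: (i) c' ≤ c; (ii) for every k, 0 ≤ g⁺(k), 0 ≤ g⁻(k), and g⁺(k) + g⁻(k) ≤ 1; (iii) the balance relation a(k)·g⁺(k) = a(k+1)·g⁻(k+1) holds for every k. -/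
/-- Diffusing orbital test on an orbit with positive weights `a : ℤ → ℝ`:
with `c = ⨅ k, (a (k+1) + a (k−1))⁻¹` and `c' = (1/2)·⨅ k, (a k)⁻¹`, the forward
and backward acceptance probabilities `g⁺ k = c·a (k+1)`, `g⁻ k = c·a (k−1)`
are valid sub-probabilities satisfying the balance relation, and `c' ≤ c`. -/
theorem diffusing_orbital_test_properties
    (a : ℤ → ℝ) (ha : ∀ k, 0 < a k)
    (c c' : ℝ)
    (hc : c = ⨅ k : ℤ, (a (k + 1) + a (k - 1))⁻¹)
    (hc' : c' = (1 / 2) * ⨅ k : ℤ, (a k)⁻¹)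
    (gp gm : ℤ → ℝ)
    (hgp : ∀ k, gp k = c * a (k + 1)) (hgm : ∀ k, gm k = c * a (k - 1)) :
    c' ≤ c ∧
      (∀ k : ℤ, 0 ≤ gp k ∧ 0 ≤ gm k ∧ gp k + gm k ≤ 1) ∧
      (∀ k : ℤ, a k * gp k = a (k + 1) * gm (k + 1)) := by
  have hpos : ∀ k : ℤ, 0 < a (k + 1) + a (k - 1) := fun k => add_pos (ha _) (ha _)
  have hb : BddBelow (Set.range fun k : ℤ => (a (k + 1) + a (k - 1))⁻¹) :=
    ⟨0, by rintro _ ⟨k, rfl⟩; exact (inv_pos.2 (hpos k)).le⟩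
  have hb' : BddBelow (Set.range fun k : ℤ => (a k)⁻¹) :=
    ⟨0, by rintro _ ⟨k, rfl⟩; exact (inv_pos.2 (ha k)).le⟩
  have hc0 : 0 ≤ c := by
    rw [hc]
    exact le_ciInf fun k => (inv_pos.2 (hpos k)).le
  have hcle : ∀ k : ℤ, c * (a (k + 1) + a (k - 1)) ≤ 1 := fun k => by
    have h : c ≤ (a (k + 1) + a (k - 1))⁻¹ := hc ▸ ciInf_le hb k
    calc _ ≤ (a (k + 1) + a (k - 1))⁻¹ * (a (k + 1) + a (k - 1)) :=
          mul_le_mul_of_nonneg_right h (hpos k).le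
      _ = 1 := inv_mul_cancel₀ (hpos k).ne'
  have hm : ∀ k : ℤ, (⨅ k : ℤ, (a k)⁻¹) * a k ≤ 1 := fun k => by
    calc _ ≤ (a k)⁻¹ * a k := mul_le_mul_of_nonneg_right (ciInf_le hb' k) (ha k).le
      _ = 1 := inv_mul_cancel₀ (ha k).ne'
  refine ⟨?_, fun k => ⟨?_, ?_, ?_⟩, fun k => ?_⟩
  · rw [hc, hc']
    refine le_ciInf fun k => ?_
    rw [← one_div (a (k + 1) + a (k - 1)), le_div_iff₀ (hpos k)]
    linarith [hm (k + 1), hm (k - 1)]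
  · rw [hgp]; exact mul_nonneg hc0 (ha _).le
  · rw [hgm]; exact mul_nonneg hc0 (ha _).le
  · rw [hgp, hgm]; linarith [hcle k]
  · rw [hgp, hgm, add_sub_cancel_right]; ring
end

section
/- Let T be a positive natural number and g : ZMod T → ℝ with 0 < g(i) for all i and g(i+1) + g(i−1) ≤ 1 for all i (indices in ZMod T). Define weights ω : ℕ → ZMod T → ℝ by ω(0)(0) = 1, ω(0)(i) = 0 for i ≠ 0, and the recurrence ω(t+1)(i) = (1 − g(i+1) − g(i−1))·ω(t)(i) + g(i)·( ω(t)(i−1) + ω(t)(i+1) ). Then for every i ∈ ZMod T, the time averages converge: lim_{n→∞} (1/n)·∑_{t=0}^{n−1} ω(t)(i) = g(i) / ( ∑_{j ∈ ZMod T} g(j) ). -/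
open Filter

/-- Evolution of a point mass under the diffusing orbital kernel on a periodic
orbit of period `T`: the time averages of the weight at orbit point `i` converge
to `g i / ∑ j, g j`. -/
theorem diffusing_orbital_periodic_time_average
    (T : ℕ) [NeZero T] (g : ZMod T → ℝ) (hgpos : ∀ i, 0 < g i)
    (hsub : ∀ i : ZMod T, g (i + 1) + g (i - 1) ≤ 1)
    (ω : ℕ → ZMod T → ℝ)
    (hω00 : ω 0 0 = 1) (hω0 : ∀ i : ZMod T, i ≠ 0 → ω 0 i = 0)
    (hrec : ∀ t (i : ZMod T),
      ω (t + 1) i = (1 - g (i + 1) - g (i - 1)) * ω t i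
        + g i * (ω t (i - 1) + ω t (i + 1))) :
    ∀ i : ZMod T,
      Tendsto (fun n : ℕ => (1 / (n : ℝ)) * ∑ t ∈ Finset.range n, ω t i)
        atTop (nhds (g i / ∑ j : ZMod T, g j)) := by
  have shift : ∀ f : ZMod T → ℝ, ∑ i, f (i + 1) = ∑ i, f i := fun f =>
    Equiv.sum_comp (Equiv.addRight (1 : ZMod T)) f
  have hnn : ∀ t i, 0 ≤ ω t i := by
    intro t
    induction t with
    | zero =>
      intro i
      by_cases h : i = 0
      · rw [h, hω00]; exact zero_le_one
      · rw [hω0 i h]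
    | succ t ih =>
      intro i
      rw [hrec]
      have h1 : 0 ≤ 1 - g (i + 1) - g (i - 1) := by linarith [hsub i]
      exact add_nonneg (mul_nonneg h1 (ih i))
        (mul_nonneg (hgpos i).le (add_nonneg (ih _) (ih _)))
  have hsum : ∀ t, ∑ i, ω t i = 1 := by
    intro t
    induction t with
    | zero =>
      rw [Finset.sum_eq_single 0 (fun i _ h => hω0 i h) (by simp), hω00]
    | succ t ih =>
      have h1 := shift (fun i => g (i - 1) * ω t i - g i * ω t (i - 1))
      have h2 := shift (fun i => g i * ω t (i - 1) - g (i - 1) * ω t i)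
      simp only [add_sub_cancel_right] at h1 h2
      rw [← ih]
      have h3 : ∀ i, ω (t + 1) i = ω t i
          + ((g i * ω t (i + 1) - g (i + 1) * ω t i)
            - (g (i - 1) * ω t i - g i * ω t (i - 1))) := by
        intro i; rw [hrec]; ring
      simp only [h3]
      rw [Finset.sum_add_distrib, Finset.sum_sub_distrib, h1]
      ring
  have hle : ∀ t i, ω t i ≤ 1 := by
    intro t i
    rw [← hsum t]
    exact Finset.single_le_sum (fun j _ => hnn t j) (Finset.mem_univ i)
  set a : ℕ → ZMod T → ℝ := fun n i => (1 / (n : ℝ)) * ∑ t ∈ Finset.range n, ω t i with ha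
  set e : ℕ → ZMod T → ℝ := fun n i => (1 / (n : ℝ)) * (ω n i - ω 0 i) with he
  have ha0 : ∀ n i, 0 ≤ a n i := fun n i =>
    mul_nonneg (by positivity) (Finset.sum_nonneg fun t _ => hnn t i)
  have ha1 : ∀ n i, a n i ≤ 1 := by
    intro n i
    have h : ∑ t ∈ Finset.range n, ω t i ≤ n := by
      calc _ ≤ ∑ t ∈ Finset.range n, (1 : ℝ) := Finset.sum_le_sum fun t _ => hle t i
        _ = n := by simp
    simp only [ha]
    rw [one_div_mul_eq_div]
    exact div_le_one_of_le₀ h (by positivity)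
  have hasum : ∀ n : ℕ, 0 < n → ∑ i, a n i = 1 := by
    intro n hn
    simp only [ha]
    rw [← Finset.mul_sum, Finset.sum_comm]
    simp only [hsum]
    have : (n : ℝ) ≠ 0 := by positivity
    simp [this]
  have hea : ∀ n i, e n i = - (g (i + 1) + g (i - 1)) * a n i
      + g i * (a n (i - 1) + a n (i + 1)) := by
    intro n i
    simp only [he, ha]
    rw [← Finset.sum_range_sub (fun t => ω t i) n]
    have : ∀ t, ω (t + 1) i - ω t i = - (g (i + 1) + g (i - 1)) * ω t i
      + g i * (ω t (i - 1) + ω t (i + 1)) := by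
      intro t; rw [hrec]; ring
    simp only [this]
    rw [Finset.sum_add_distrib, ← Finset.mul_sum, ← Finset.mul_sum, Finset.sum_add_distrib]
    ring
  have hinv : Tendsto (fun n : ℕ => 1 / (n : ℝ)) atTop (nhds 0) :=
    tendsto_one_div_atTop_nhds_zero_nat
  have hetend : ∀ i, Tendsto (fun n => e n i * (a n i / g i)) atTop (nhds 0) := by
    intro i
    have hb : Tendsto (fun n : ℕ => 1 / (n : ℝ) * (1 / g i)) atTop (nhds 0) := by
      simpa using hinv.mul_const (1 / g i)
    refine squeeze_zero_norm (fun n => ?_) hb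
    have h1 : |ω n i - ω 0 i| ≤ 1 := by
      rw [abs_le]; constructor <;> linarith [hnn n i, hnn 0 i, hle n i, hle 0 i]
    have h2 : |a n i / g i| ≤ 1 / g i := by
      rw [abs_of_nonneg (div_nonneg (ha0 n i) (hgpos i).le)]
      exact div_le_div_of_nonneg_right (ha1 n i) (hgpos i).le
    have h0 : (0 : ℝ) ≤ 1 / (n : ℝ) := by positivity
    rw [Real.norm_eq_abs, abs_mul]
    refine mul_le_mul ?_ h2 (abs_nonneg _) h0
    simp only [he]
    rw [abs_mul, abs_of_nonneg h0]
    exact mul_le_of_le_one_right h0 h1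
  have hen : ∀ n, ∑ i, g i * g (i + 1) * (a n (i + 1) / g (i + 1) - a n i / g i) ^ 2
      = - ∑ i, e n i * (a n i / g i) := by
    intro n
    have h1 := shift (fun i => g (i - 1) * g i * (a n i / g i - a n (i - 1) / g (i - 1))
      * (a n i / g i))
    simp only [add_sub_cancel_right] at h1
    have h3 : ∀ i, e n i * (a n i / g i)
        = g i * g (i + 1) * (a n (i + 1) / g (i + 1) - a n i / g i) * (a n i / g i)
        - g (i - 1) * g i * (a n i / g i - a n (i - 1) / g (i - 1)) * (a n i / g i) := by
      intro i
      rw [hea]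
      have := (hgpos i).ne'
      have := (hgpos (i + 1)).ne'
      have := (hgpos (i - 1)).ne'
      field_simp
      ring
    simp only [h3]
    rw [Finset.sum_sub_distrib, ← h1, ← Finset.sum_sub_distrib, ← Finset.sum_neg_distrib]
    refine Finset.sum_congr rfl fun i _ => ?_
    ring
  have hE : Tendsto (fun n => ∑ i, g i * g (i + 1)
      * (a n (i + 1) / g (i + 1) - a n i / g i) ^ 2) atTop (nhds 0) := by
    simp only [hen]
    have := (tendsto_finsetSum Finset.univ (fun i _ => hetend i)).neg
    simpa using this
  have hd : ∀ i, Tendsto (fun n => a n (i + 1) / g (i + 1) - a n i / g i) atTop (nhds 0) := by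
    intro i
    have hc : 0 < g i * g (i + 1) := mul_pos (hgpos _) (hgpos _)
    have h1 : Tendsto (fun n => g i * g (i + 1)
      * (a n (i + 1) / g (i + 1) - a n i / g i) ^ 2) atTop (nhds 0) := by
      refine squeeze_zero (fun n => mul_nonneg hc.le (sq_nonneg _)) (fun n => ?_) hE
      exact Finset.single_le_sum (f := fun i => g i * g (i + 1)
        * (a n (i + 1) / g (i + 1) - a n i / g i) ^ 2)
        (fun j _ => mul_nonneg (mul_pos (hgpos _) (hgpos _)).le (sq_nonneg _))
        (Finset.mem_univ i)
    have h2 : Tendsto (fun n => (a n (i + 1) / g (i + 1) - a n i / g i) ^ 2)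
        atTop (nhds 0) := by
      have := h1.const_mul (g i * g (i + 1))⁻¹
      simpa only [inv_mul_cancel_left₀ hc.ne', mul_zero] using this
    have h3 := h2.sqrt
    simp only [Real.sqrt_sq_eq_abs, Real.sqrt_zero] at h3
    exact (tendsto_zero_iff_abs_tendsto_zero _).2 h3
  have hd0 : ∀ k : ℕ, Tendsto (fun n => a n (k : ZMod T) / g (k : ZMod T) - a n 0 / g 0)
      atTop (nhds 0) := by
    intro k
    induction k with
    | zero => simp
    | succ k ih =>
      have := (hd (k : ZMod T)).add ih
      simpa using this
  have hdz : ∀ i : ZMod T, Tendsto (fun n => a n i / g i - a n 0 / g 0) atTop (nhds 0) := by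
    intro i
    have := hd0 i.val
    simpa only [ZMod.natCast_zmod_val] using this
  have hG : 0 < ∑ j, g j := Finset.sum_pos (fun j _ => hgpos j) Finset.univ_nonempty
  intro i
  change Tendsto (fun n => a n i) atTop _
  have hS : Tendsto (fun n => ∑ j, g j * ((a n i / g i - a n 0 / g 0)
      - (a n j / g j - a n 0 / g 0))) atTop (nhds 0) := by
    have := tendsto_finsetSum Finset.univ
      (fun j _ => ((hdz i).sub (hdz j)).const_mul (g j))
    simpa using this
  have hF := (hS.add_const 1).mul_const (g i / ∑ j, g j)
  rw [zero_add, one_mul] at hF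
  refine hF.congr' ?_
  filter_upwards [eventually_gt_atTop 0] with n hn
  have h1 : ∀ j, g j * ((a n i / g i - a n 0 / g 0) - (a n j / g j - a n 0 / g 0))
      = g j * (a n i / g i) - a n j := by
    intro j
    have := (hgpos j).ne'
    have h : g j * (a n j / g j) = a n j := by field_simp
    linear_combination -h
  simp only [h1]
  rw [Finset.sum_sub_distrib, hasum n hn, ← Finset.sum_mul]
  have := (hgpos i).ne'
  have := hG.ne'
  field_simp
  ring
end

section
/- Let g : ℤ → ℝ satisfy 0 < g(k) for all k, g(k+1) + g(k−1) ≤ 1 for all k, and suppose g is summable over ℤ with total sum S := ∑'_{k∈ℤ} g(k). Define weights ω : ℕ → ℤ → ℝ by ω(0)(0) = 1, ω(0)(i) = 0 for i ≠ 0, and the recurrence ω(t+1)(i) = (1 − g(i+1) − g(i−1))·ω(t)(i) + g(i)·( ω(t)(i−1) + ω(t)(i+1) ). Then for every i ∈ ℤ, the time averages converge: lim_{n→∞} (1/n)·∑_{t=0}^{n−1} ω(t)(i) = g(i)/S. -/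
open Filter

/-- Evolution of a point mass under the diffusing orbital kernel on an aperiodic
(infinite) orbit: if the weights `g : ℤ → ℝ` are summable with total sum `S`,
the time averages of the mass at orbit point `i` converge to `g i / S`. -/
theorem diffusing_orbital_aperiodic_time_average
    (g : ℤ → ℝ) (hgpos : ∀ k, 0 < g k)
    (hsub : ∀ k : ℤ, g (k + 1) + g (k - 1) ≤ 1)
    (hsummable : Summable g) (S : ℝ) (hS : S = ∑' k : ℤ, g k)
    (ω : ℕ → ℤ → ℝ)
    (hω00 : ω 0 0 = 1) (hω0 : ∀ i : ℤ, i ≠ 0 → ω 0 i = 0)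
    (hrec : ∀ t (i : ℤ),
      ω (t + 1) i = (1 - g (i + 1) - g (i - 1)) * ω t i
        + g i * (ω t (i - 1) + ω t (i + 1))) :
    ∀ i : ℤ,
      Tendsto (fun n : ℕ => (1 / (n : ℝ)) * ∑ t ∈ Finset.range n, ω t i)
        atTop (nhds (g i / S)) := by
  have hg0 := hgpos 0
  have hg1 : ∀ k, g k ≤ 1 := by
    intro k
    have h1 := hsub (k - 1)
    have h2 := hgpos (k - 1 - 1)
    rw [sub_add_cancel] at h1
    linarith
  have hSpos : 0 < S := by
    rw [hS]; exact hsummable.tsum_pos (fun k => (hgpos k).le) 0 hg0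
  obtain ⟨c, hc⟩ : ∃ c, c = 1 / g 0 := ⟨_, rfl⟩
  have hcpos : 0 < c := by rw [hc]; positivity
  have hb : ∀ t i, 0 ≤ ω t i ∧ ω t i ≤ c * g i := by
    intro t
    induction t with
    | zero =>
      intro i
      by_cases hi : i = 0
      · subst hi
        rw [hω00, hc]
        constructor
        · norm_num
        · rw [one_div, inv_mul_cancel₀ hg0.ne']
      · rw [hω0 i hi]
        exact ⟨le_rfl, (mul_pos hcpos (hgpos i)).le⟩
    | succ t ih =>
      intro i
      rw [hrec]
      have hs : 0 ≤ 1 - g (i + 1) - g (i - 1) := by linarith [hsub i]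
      have h1 := ih i
      have h2 := ih (i - 1)
      have h3 := ih (i + 1)
      have hgi := (hgpos i).le
      constructor
      · exact add_nonneg (mul_nonneg hs h1.1) (mul_nonneg hgi (add_nonneg h2.1 h3.1))
      · have e1 := mul_le_mul_of_nonneg_left h1.2 hs
        have e2 := mul_le_mul_of_nonneg_left (add_le_add h2.2 h3.2) hgi
        linarith
  have hcg : Summable (fun i => c * g i) := hsummable.mul_left c
  have hsum : ∀ t, Summable (ω t) := fun t =>
    Summable.of_nonneg_of_le (fun i => (hb t i).1) (fun i => (hb t i).2) hcg
  have hmass : ∀ t, HasSum (ω t) 1 := by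
    intro t
    induction t with
    | zero =>
      have := hasSum_single (f := ω 0) 0 hω0
      rwa [hω00] at this
    | succ t ih =>
      obtain ⟨f, hf⟩ : ∃ f : ℤ → ℝ, f = fun i => g i * ω t (i + 1) - g (i + 1) * ω t i := ⟨_, rfl⟩
      have hfs : Summable f := by
        rw [hf]
        apply Summable.sub
        · refine Summable.of_nonneg_of_le (fun i => mul_nonneg (hgpos i).le (hb t _).1) (fun i => ?_)
            ((Equiv.addRight (1 : ℤ)).summable_iff.mpr (hsum t))
          exact mul_le_of_le_one_left (hb t _).1 (hg1 i)
        · refine Summable.of_nonneg_of_le (fun i => mul_nonneg (hgpos _).le (hb t _).1) (fun i => ?_)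
            (hsum t)
          exact mul_le_of_le_one_left (hb t _).1 (hg1 _)
      obtain ⟨a, ha⟩ := hfs
      have ha' : HasSum (fun i => f (i - 1)) a := (Equiv.subRight (1 : ℤ)).hasSum_iff.mpr ha
      have := ih.add (ha.sub ha')
      rw [sub_self, add_zero] at this
      convert this using 1
      funext i
      rw [hrec, hf]
      simp only [sub_add_cancel]
      ring
  obtain ⟨W, hW⟩ : ∃ W : ℕ → ℤ → ℝ,
    W = fun (n : ℕ) i => (1 / (n : ℝ)) * ∑ t ∈ Finset.range n, ω t i := ⟨_, rfl⟩
  have hW0 : ∀ n i, 0 ≤ W n i := by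
    intro n i
    rw [hW]
    exact mul_nonneg (by positivity) (Finset.sum_nonneg fun t _ => (hb t i).1)
  have hWc : ∀ n i, W n i ≤ c * g i := by
    intro n i
    rw [hW]
    have h1 : ∑ t ∈ Finset.range n, ω t i ≤ n * (c * g i) := by
      have := Finset.sum_le_sum (s := Finset.range n) fun t _ => (hb t i).2
      simpa using this
    rcases Nat.eq_zero_or_pos n with h | h
    · subst h
      simpa using (mul_pos hcpos (hgpos i)).le
    · have hn : (0 : ℝ) < n := by exact_mod_cast h
      show 1 / (n : ℝ) * _ ≤ _
      rw [one_div, inv_mul_le_iff₀ hn]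
      exact h1
  have hWmass : ∀ n, 0 < n → HasSum (W n) 1 := by
    intro n h
    have hn : (n : ℝ) ≠ 0 := by exact_mod_cast h.ne'
    have h1 : HasSum (fun i => ∑ t ∈ Finset.range n, ω t i) (∑ t ∈ Finset.range n, (1 : ℝ)) :=
      hasSum_sum fun t _ => hmass t
    have h2 := h1.mul_left (1 / (n : ℝ))
    have h3 : (1 / (n : ℝ)) * (∑ t ∈ Finset.range n, (1 : ℝ)) = 1 := by
      simp [hn]
    rw [h3] at h2
    rw [hW]
    exact h2
  obtain ⟨F, hF⟩ : ∃ F : ℕ → ℤ → ℝ,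
    F = fun n i => g i * W n (i + 1) - g (i + 1) * W n i := ⟨_, rfl⟩
  have hFstep : ∀ n i, F n (i + 1) - F n i = (1 / (n : ℝ)) * (ω n (i + 1) - ω 0 (i + 1)) := by
    intro n i
    rw [← Finset.sum_range_sub (fun t => ω t (i + 1)) n, hF, hW]
    simp only [hrec, add_sub_cancel_right]
    simp only [Finset.mul_sum, ← Finset.sum_sub_distrib]
    apply Finset.sum_congr rfl
    intro t _
    ring
  have hFstep0 : ∀ i, Tendsto (fun n => F n (i + 1) - F n i) atTop (nhds 0) := by
    intro i
    simp only [hFstep]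
    refine tendsto_one_div_atTop_nhds_zero_nat.zero_mul_isBoundedUnder_le ?_
    refine isBoundedUnder_of ⟨c * g (i + 1) + |ω 0 (i + 1)|, fun n => ?_⟩
    have := hb n (i + 1)
    simp only [Function.comp, Real.norm_eq_abs]
    calc |ω n (i + 1) - ω 0 (i + 1)| ≤ |ω n (i + 1)| + |ω 0 (i + 1)| := abs_sub _ _
      _ ≤ _ := by rw [abs_of_nonneg this.1]; linarith
  have hFK : ∀ i (K : ℕ), Tendsto (fun n => F n (i + K) - F n i) atTop (nhds 0) := by
    intro i K
    induction K with
    | zero => simp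
    | succ K ih =>
      have := (hFstep0 (i + K)).add ih
      simp only [sub_add_sub_cancel, add_zero] at this
      simpa [add_assoc] using this
  have hFb : ∀ n i, |F n i| ≤ c * g i := by
    intro n i
    have h1 := hgpos i
    have h2 := hgpos (i + 1)
    have e1 := mul_le_mul_of_nonneg_left (hWc n (i + 1)) h1.le
    have e2 := mul_le_mul_of_nonneg_left (hWc n i) h2.le
    have e3 := mul_nonneg h1.le (hW0 n (i + 1))
    have e4 := mul_nonneg h2.le (hW0 n i)
    have e5 := mul_le_mul_of_nonneg_left (hg1 (i + 1)) (mul_pos hcpos h1).le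
    rw [hF, abs_le]
    constructor <;> nlinarith
  have hF0 : ∀ i, Tendsto (fun n => F n i) atTop (nhds 0) := by
    intro i
    have hgK : Tendsto (fun K : ℕ => c * g (i + K)) atTop (nhds 0) := by
      have hinj : Function.Injective (fun K : ℕ => i + (K : ℤ)) := by
        intro a b h
        simpa using h
      have := hcg.tendsto_cofinite_zero.comp hinj.tendsto_cofinite
      rwa [Nat.cofinite_eq_atTop] at this
    rw [Metric.tendsto_atTop]
    intro ε hε
    obtain ⟨K, hK⟩ := (hgK.eventually (gt_mem_nhds (half_pos hε))).exists
    obtain ⟨N, hN⟩ := (Metric.tendsto_atTop.mp (hFK i K)) (ε / 2) (half_pos hε)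
    refine ⟨N, fun n hn => ?_⟩
    have h1 := hN n hn
    have h2 := hFb n (i + K)
    rw [Real.dist_eq, sub_zero] at h1 ⊢
    rw [abs_lt] at h1 ⊢
    rw [abs_le] at h2
    constructor <;> linarith [h1.1, h1.2, h2.1, h2.2]
  have hDstep : ∀ i, Tendsto (fun n : ℕ => W n (i + 1) / g (i + 1) - W n i / g i) atTop (nhds 0) := by
    intro i
    have h := (hF0 i).div_const (g i * g (i + 1))
    rw [zero_div] at h
    refine h.congr fun n => ?_
    rw [hF]
    have h1 := (hgpos i).ne'
    have h2 := (hgpos (i + 1)).ne'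
    field_simp
  have hD : ∀ i, Tendsto (fun n => W n i / g i - W n 0 / g 0) atTop (nhds 0) := by
    intro i
    induction i using Int.induction_on with
    | zero => simp
    | succ k ih =>
      have := (hDstep k).add ih
      simpa only [sub_add_sub_cancel, add_zero] using this
    | pred k ih =>
      have := ih.sub (hDstep (-(k : ℤ) - 1))
      simp only [sub_add_cancel, sub_zero] at this
      refine this.congr fun n => ?_
      ring
  have hT : Tendsto (fun n => ∑' i, g i * (W n i / g i - W n 0 / g 0)) atTop
      (nhds (∑' i : ℤ, (0 : ℝ))) := by
    refine tendsto_tsum_of_dominated_convergence hcg ?_ ?_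
    · intro i
      simpa using (hD i).const_mul (g i)
    · refine Eventually.of_forall fun n i => ?_
      have a1 : ∀ j, 0 ≤ W n j / g j ∧ W n j / g j ≤ c := fun j =>
        ⟨div_nonneg (hW0 n j) (hgpos j).le, (div_le_iff₀ (hgpos j)).mpr (hWc n j)⟩
      rw [Real.norm_eq_abs, abs_mul, abs_of_pos (hgpos i), mul_comm c]
      refine mul_le_mul_of_nonneg_left ?_ (hgpos i).le
      rw [abs_le]
      constructor <;> linarith [(a1 i).1, (a1 i).2, (a1 0).1, (a1 0).2]
  rw [tsum_zero] at hT
  have hT' : Tendsto (fun n => 1 - S * (W n 0 / g 0)) atTop (nhds 0) := by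
    refine hT.congr' ?_
    filter_upwards [eventually_gt_atTop 0] with n hn
    have h1 : HasSum g S := hS ▸ hsummable.hasSum
    have h2 := (hWmass n hn).sub (h1.mul_right (W n 0 / g 0))
    rw [← h2.tsum_eq]
    refine tsum_congr fun i => ?_
    rw [mul_sub, mul_div_cancel₀ _ (hgpos i).ne']
  have hlim0 : Tendsto (fun n => W n 0 / g 0) atTop (nhds (1 / S)) := by
    have h := (hT'.const_sub 1).div_const S
    rw [sub_zero] at h
    refine h.congr fun n => ?_
    rw [sub_sub_cancel, mul_div_cancel_left₀ _ hSpos.ne']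
  intro i
  have h := ((hD i).add hlim0).const_mul (g i)
  rw [zero_add, mul_one_div] at h
  have : Tendsto (fun n => W n i) atTop (nhds (g i / S)) := by
    refine h.congr fun n => ?_
    rw [sub_add_cancel, mul_div_cancel₀ _ (hgpos i).ne']
  rw [hW] at this
  exact this
end

section
/- Let X be a measurable space, p a σ-finite measure on X, and F : ℤ → X → X a measurable ℤ-action: each F(m) is measurable, F(0) = id, and F(m+n) = F(m) ∘ F(n) for all m, n ∈ ℤ. Let s be a finite set of integers closed under negation (m ∈ s → −m ∈ s), w : ℤ → [0,∞] weights, and g : ℤ → X → [0,∞] measurable functions with g(m)(x) ≤ 1 for all m, x. Assume: (i) for every m ∈ s, Measure.map (F m) (p.withDensity (g m)) = p.withDensity (g m) (each component kernel leaves p invariant); and (ii) for every m ∈ s and every x, w(−m)·g(−m)(x) = w(m)·g(m)(x). Then the linear combination kernel is reversible with respect to p: for all measurable sets A and B, ∫⁻_{x∈A} ∑_{m∈s} w(m)·( g(m)(x)·𝟙_B(F(m)(x)) + (1 − g(m)(x))·𝟙_B(x) ) dp(x) = ∫⁻_{x∈B} ∑_{m∈s} w(m)·( g(m)(x)·𝟙_A(F(m)(x))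 + (1 − g(m)(x))·𝟙_A(x) ) dp(x). -/
open MeasureTheory
open scoped ENNReal

/-- Reversibility of a linear combination of escaping orbital kernels: given a
measurable `ℤ`-action `F`, a negation-closed finite set `s` of steps, weights `w`
and acceptance tests `g m ≤ 1` such that each component kernel leaves `p`
invariant and `w (−m)·g (−m) = w m · g m` on `s`, the combined kernel
`κ(x) = ∑_{m∈s} w m·(g m x•δ_{F m x} + (1 − g m x)•δ_x)` is reversible w.r.t. `p`. -/
theorem linear_combination_orbital_kernel_reversible
    {X : Type*} [MeasurableSpace X] (p : Measure X) [SigmaFinite p]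
    (F : ℤ → X → X) (hFmeas : ∀ m, Measurable (F m))
    (hF0 : F 0 = id) (hFadd : ∀ m n : ℤ, F (m + n) = F m ∘ F n)
    (s : Finset ℤ) (hs : ∀ m ∈ s, -m ∈ s)
    (w : ℤ → ℝ≥0∞) (g : ℤ → X → ℝ≥0∞)
    (hgmeas : ∀ m, Measurable (g m)) (hg1 : ∀ m x, g m x ≤ 1)
    (hinv : ∀ m ∈ s,
      Measure.map (F m) (p.withDensity (g m)) = p.withDensity (g m))
    (hbal : ∀ m ∈ s, ∀ x, w (-m) * g (-m) x = w m * g m x) :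
    ∀ A B : Set X, MeasurableSet A → MeasurableSet B →
      ∫⁻ x in A, ∑ m ∈ s, w m * (g m x * B.indicator (1 : X → ℝ≥0∞) (F m x)
          + (1 - g m x) * B.indicator (1 : X → ℝ≥0∞) x) ∂p =
        ∫⁻ x in B, ∑ m ∈ s, w m * (g m x * A.indicator (1 : X → ℝ≥0∞) (F m x)
          + (1 - g m x) * A.indicator (1 : X → ℝ≥0∞) x) ∂p := by
  intro A B hA hB
  have hI : ∀ {C : Set X}, MeasurableSet C → Measurable (C.indicator (1 : X → ℝ≥0∞)) :=
    fun hC => measurable_one.indicator hC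
  have hsplit : ∀ A B : Set X, MeasurableSet A → MeasurableSet B →
      ∫⁻ x in A, ∑ m ∈ s, w m * (g m x * B.indicator (1 : X → ℝ≥0∞) (F m x)
          + (1 - g m x) * B.indicator (1 : X → ℝ≥0∞) x) ∂p =
      ∑ m ∈ s, (∫⁻ x, w m * g m x * (A.indicator (1 : X → ℝ≥0∞) x *
          B.indicator (1 : X → ℝ≥0∞) (F m x)) ∂p +
        ∫⁻ x, w m * (1 - g m x) * (A.indicator (1 : X → ℝ≥0∞) x *
          B.indicator (1 : X → ℝ≥0∞) x) ∂p) := by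
    intro A B hA hB
    have hA' := hI hA
    have hB' := hI hB
    have hBF : ∀ m, Measurable (fun x => B.indicator (1 : X → ℝ≥0∞) (F m x)) :=
      fun m => hB'.comp (hFmeas m)
    rw [← lintegral_indicator hA]
    have h1 : ∀ m ∈ s, (∫⁻ x, w m * g m x * (A.indicator (1 : X → ℝ≥0∞) x *
          B.indicator (1 : X → ℝ≥0∞) (F m x)) ∂p +
        ∫⁻ x, w m * (1 - g m x) * (A.indicator (1 : X → ℝ≥0∞) x *
          B.indicator (1 : X → ℝ≥0∞) x) ∂p) =
        ∫⁻ x, (w m * g m x * (A.indicator (1 : X → ℝ≥0∞) x *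
          B.indicator (1 : X → ℝ≥0∞) (F m x)) + w m * (1 - g m x) *
          (A.indicator (1 : X → ℝ≥0∞) x * B.indicator (1 : X → ℝ≥0∞) x)) ∂p := by
      intro m _
      rw [lintegral_add_left]
      exact ((hgmeas m).const_mul _).mul (hA'.mul (hBF m))
    rw [Finset.sum_congr rfl h1, ← lintegral_finsetSum]
    · refine lintegral_congr fun x => ?_
      by_cases hx : x ∈ A
      · simp only [Set.indicator_of_mem hx, Pi.one_apply, one_mul]
        exact Finset.sum_congr rfl fun m _ => by ring
      · simp [Set.indicator_of_notMem hx]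
    · intro m _
      exact (((hgmeas m).const_mul _).mul (hA'.mul (hBF m))).add
        (((measurable_const.sub (hgmeas m)).const_mul _).mul (hA'.mul hB'))
  have hkey : ∀ m ∈ s,
      ∫⁻ x, w m * g m x * (A.indicator (1 : X → ℝ≥0∞) x *
          B.indicator (1 : X → ℝ≥0∞) (F m x)) ∂p =
      ∫⁻ x, w (-m) * g (-m) x * (B.indicator (1 : X → ℝ≥0∞) x *
          A.indicator (1 : X → ℝ≥0∞) (F (-m) x)) ∂p := by
    intro m hm
    have hinvF : ∀ x, F (-m) (F m x) = x := fun x => by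
      have := congrFun (hFadd (-m) m) x
      simpa [hF0] using this.symm
    have hA1 : Measurable (fun x => A.indicator (1 : X → ℝ≥0∞) x *
        B.indicator (1 : X → ℝ≥0∞) (F m x)) := (hI hA).mul ((hI hB).comp (hFmeas m))
    have hB1 : Measurable (fun x => B.indicator (1 : X → ℝ≥0∞) x *
        A.indicator (1 : X → ℝ≥0∞) (F (-m) x)) := (hI hB).mul ((hI hA).comp (hFmeas (-m)))
    simp_rw [hbal m hm, mul_assoc (w m)]
    refine (lintegral_const_mul _ ((hgmeas m).mul hA1)).trans
      (Eq.trans ?_ (lintegral_const_mul _ ((hgmeas m).mul hB1)).symm)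
    congr 1
    simp only [Pi.mul_apply]
    have e1 := lintegral_withDensity_eq_lintegral_mul p (hgmeas m) hA1
    have e2 := lintegral_withDensity_eq_lintegral_mul p (hgmeas m) hB1
    simp only [Pi.mul_apply] at e1 e2
    rw [← e1, ← e2]
    conv_rhs => rw [← hinv m hm]
    rw [lintegral_map hB1 (hFmeas m)]
    simp_rw [hinvF, mul_comm]
  rw [hsplit A B hA hB, hsplit B A hB hA, Finset.sum_add_distrib, Finset.sum_add_distrib]
  congr 1
  · rw [Finset.sum_congr rfl hkey]
    exact Finset.sum_nbij' (fun m => -m) (fun m => -m) hs hs (by simp) (by simp) (by simp)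
  · refine Finset.sum_congr rfl fun m _ => lintegral_congr fun x => ?_
    rw [mul_comm (A.indicator _ x)]
end
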